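/- arXiv:2311.12374 — 2 statements merged into one kernel-verified Lean document; each statement's English description precedes it below -/
import Mathlib

section
/- Fix μ > 0. Let j be a nonnegative integer and suppose ∂_y^j u₀ ∈ L¹(ℝ²). Then for every nonnegative integer l there is a constant C > 0 (independent of u₀ and t) such that for all t > 0, ‖U_l(·,·,t) * (∂_y^j u₀)‖_{L^∞(ℝ²)} ≤ C t^{−3/4 − l/2} ‖∂_y^j u₀‖_{L¹}, where * denotes convolution in (x,y); equivalently, ‖∂ₓˡ∂_y^j(U(t)u₀)‖_{L^∞} ≤ C t^{−3/4−l/2}‖∂_y^j u₀‖_{L¹} for the linear solution U(t)u₀. -/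
open MeasureTheory Filter Complex

noncomputable section

/-- The kernel `U_l = ∂ₓˡ U`, where `U` is the fundamental solution of the linearized
equation `u_t + u_{xxx} + u_{yyx} - μ u_{xx} = 0`:
`U_l(x,y,t) = (t^{-1/2}/(4π^{3/2})) ∫ (iξ)^l |ξ|^{-1/2} e^{-μtξ²}
  exp(i(tξ³ - y²/(4tξ) + (π/4) sgn ξ + xξ)) dξ`. -/
def kernelU (μ : ℝ) (l : ℕ) (x y t : ℝ) : ℂ :=
  ((t ^ (-(1:ℝ)/2) / (4 * Real.pi ^ ((3:ℝ)/2)) : ℝ) : ℂ) *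
    ∫ ξ : ℝ, (Complex.I * (ξ : ℂ)) ^ l *
      ((|ξ| ^ (-(1:ℝ)/2) * Real.exp (-(μ * t) * ξ ^ 2) : ℝ) : ℂ) *
      Complex.exp (Complex.I *
        ((t * ξ ^ 3 - y ^ 2 / (4 * t * ξ) + (Real.pi / 4) * Real.sign ξ + x * ξ : ℝ) : ℂ))

/-- The kernel `V_l = ∂ₓˡ V`, where `V` is the fundamental solution of
`v_t + v_{yyx} - μ v_{xx} = 0`:
`V_l(x,y,t) = (t^{-1/2}/(4π^{3/2})) ∫ (iξ)^l |ξ|^{-1/2} e^{-μtξ²}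
  exp(i(- y²/(4tξ) + (π/4) sgn ξ + xξ)) dξ`. -/
def kernelV (μ : ℝ) (l : ℕ) (x y t : ℝ) : ℂ :=
  ((t ^ (-(1:ℝ)/2) / (4 * Real.pi ^ ((3:ℝ)/2)) : ℝ) : ℂ) *
    ∫ ξ : ℝ, (Complex.I * (ξ : ℂ)) ^ l *
      ((|ξ| ^ (-(1:ℝ)/2) * Real.exp (-(μ * t) * ξ ^ 2) : ℝ) : ℂ) *
      Complex.exp (Complex.I *
        ((- y ^ 2 / (4 * t * ξ) + (Real.pi / 4) * Real.sign ξ + x * ξ : ℝ) : ℂ))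

end
/-- Uniform bound for the kernel: bring absolute values inside the oscillatory integral and
evaluate the resulting Gamma integral. -/
lemma norm_kernelU_le (μ : ℝ) (hμ : 0 < μ) (l : ℕ) (x y t : ℝ) (ht : 0 < t) :
    ‖kernelU μ l x y t‖ ≤
      (1 / (4 * Real.pi ^ ((3:ℝ)/2)) * (μ ^ (-((l : ℝ) + 1/2)/2) *
        Real.Gamma (((l : ℝ) + 1/2)/2))) * t ^ (-(3 : ℝ)/4 - (l : ℝ)/2) := by
  have hprefactor : 0 ≤ t ^ (-(1:ℝ)/2) / (4 * Real.pi ^ ((3:ℝ)/2)) := by positivity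
  have hnorm : ∀ ξ : ℝ, ‖(Complex.I * (ξ : ℂ)) ^ l *
      ((|ξ| ^ (-(1:ℝ)/2) * Real.exp (-(μ * t) * ξ ^ 2) : ℝ) : ℂ) *
      Complex.exp (Complex.I *
        ((t * ξ ^ 3 - y ^ 2 / (4 * t * ξ) + (Real.pi / 4) * Real.sign ξ + x * ξ : ℝ) : ℂ))‖
      = (fun r : ℝ => r ^ l * (r ^ (-(1:ℝ)/2) * Real.exp (-(μ * t) * r ^ 2))) |ξ| := by
    intro ξ
    have h0 : 0 ≤ |ξ| ^ (-(1:ℝ)/2) * Real.exp (-(μ * t) * ξ ^ 2) := by positivity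
    rw [norm_mul, norm_mul, Complex.norm_exp_I_mul_ofReal, norm_pow, norm_mul, Complex.norm_I,
      Complex.norm_real, Complex.norm_real, Real.norm_of_nonneg h0, Real.norm_eq_abs]
    simp only [one_mul, mul_one, sq_abs]
  have hint : ∫ r in Set.Ioi (0:ℝ), r ^ l * (r ^ (-(1:ℝ)/2) * Real.exp (-(μ * t) * r ^ 2))
      = (μ * t) ^ (-((l : ℝ) + 1/2)/2) * (1 / 2) * Real.Gamma (((l : ℝ) + 1/2)/2) := by
    have hl : (0 : ℝ) ≤ l := Nat.cast_nonneg l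
    have h := integral_rpow_mul_exp_neg_mul_rpow (p := 2) (q := (l : ℝ) - 1/2) (b := μ * t)
      two_pos (by linarith) (by positivity)
    rw [show (l : ℝ) - 1/2 + 1 = l + 1/2 by ring] at h
    rw [← h]
    refine setIntegral_congr_fun measurableSet_Ioi fun r (hr : 0 < r) => ?_
    simp only [Real.rpow_two]
    rw [← mul_assoc, ← Real.rpow_natCast r l, ← Real.rpow_add hr]
    congr 2
    ring
  have hpow : t ^ (-(1:ℝ)/2) * t ^ (-((l : ℝ) + 1/2)/2) = t ^ (-(3 : ℝ)/4 - (l : ℝ)/2) := by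
    rw [← Real.rpow_add ht]
    congr 1
    ring
  rw [kernelU, norm_mul, Complex.norm_real, Real.norm_of_nonneg hprefactor]
  refine (mul_le_mul_of_nonneg_left (norm_integral_le_integral_norm _) hprefactor).trans ?_
  rw [integral_congr_ae (ae_of_all _ hnorm), integral_comp_abs
    (f := fun r : ℝ => r ^ l * (r ^ (-(1:ℝ)/2) * Real.exp (-(μ * t) * r ^ 2))), hint, Real.mul_rpow hμ.le ht.le, ← hpow]
  apply le_of_eq
  ring

/-- `L^∞` decay estimate for the linear solution:
`‖U_l(t) * ∂_y^j u₀‖_∞ ≤ C t^{-3/4-l/2} ‖∂_y^j u₀‖_{L¹}`.  Since only the function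
`g = ∂_y^j u₀ ∈ L¹(ℝ²)` enters, the statement is quantified over `g`. -/
theorem kernelU_conv_L1_decay (μ : ℝ) (hμ : 0 < μ) (j l : ℕ) :
    ∃ C > (0 : ℝ), ∀ g : ℝ × ℝ → ℝ, Integrable g (volume : Measure (ℝ × ℝ)) →
      ∀ t : ℝ, 0 < t →
        eLpNorm (fun q : ℝ × ℝ =>
            ∫ p : ℝ × ℝ, kernelU μ l (q.1 - p.1) (q.2 - p.2) t * ((g p : ℝ) : ℂ)) ⊤
          (volume : Measure (ℝ × ℝ))
          ≤ ENNReal.ofReal (C * t ^ (-(3 : ℝ)/4 - (l : ℝ)/2) *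
              (eLpNorm g 1 (volume : Measure (ℝ × ℝ))).toReal) := by
  have hl : (0 : ℝ) < ((l : ℝ) + 1/2)/2 := by positivity
  have hΓ := Real.Gamma_pos_of_pos hl
  refine ⟨1 / (4 * Real.pi ^ ((3:ℝ)/2)) * (μ ^ (-((l : ℝ) + 1/2)/2) *
    Real.Gamma (((l : ℝ) + 1/2)/2)), by positivity, fun g hg t ht => ?_⟩
  have hL1 : (eLpNorm g 1 (volume : Measure (ℝ × ℝ))).toReal = ∫ p, ‖g p‖ := by
    rw [eLpNorm_one_eq_lintegral_enorm, integral_norm_eq_lintegral_enorm hg.aestronglyMeasurable]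
  rw [eLpNorm_exponent_top, hL1, ← integral_const_mul]
  refine eLpNormEssSup_le_of_ae_bound (ae_of_all _ fun q => ?_)
  refine norm_integral_le_of_norm_le (hg.norm.const_mul _) (ae_of_all _ fun p => ?_)
  rw [norm_mul, Complex.norm_real]
  exact mul_le_mul_of_nonneg_right (norm_kernelU_le μ hμ l _ _ t ht) (norm_nonneg _)
end

section
/- Fix μ > 0. Let j be a nonnegative integer and suppose ∂_y^j u₀ ∈ L¹(ℝ²). Define M_j(w) := ∫_ℝ ∂_y^j u₀(x,w) dx and, for t > 0, 𝒱_{j,l}(x,y,t) := ∫_ℝ V_l(x, y−w, t) M_j(w) dw. Then for every nonnegative integer l, liminf_{t→∞} t^{3/4 + l/2} ‖𝒱_{j,l}(·,·,t)‖_{L^∞(ℝ²)} ≥ (Γ((1+2l)/4) / (2^{5/2} π^{3/2} μ^{(1+2l)/4})) · |∫_ℝ M_j(y) dy|. -/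
open MeasureTheory Filter Complex

/-- The integrand of `kernelV` at time one, with `a` in place of `y ^ 2`. -/
noncomputable def profileIntegrand (μ : ℝ) (l : ℕ) (a x η : ℝ) : ℂ :=
  (Complex.I * (η : ℂ)) ^ l *
    ((|η| ^ (-(1:ℝ)/2) * Real.exp (-μ * η ^ 2) : ℝ) : ℂ) *
    Complex.exp (Complex.I * ((-a / (4 * η) + (Real.pi / 4) * Real.sign η + x * η : ℝ) : ℂ))

theorem norm_profileIntegrand (μ : ℝ) (l : ℕ) (a x η : ℝ) :
    ‖profileIntegrand μ l a x η‖ = |η| ^ l * (|η| ^ (-(1:ℝ)/2) * Real.exp (-μ * η ^ 2)) := by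
  have h : 0 ≤ |η| ^ (-(1:ℝ)/2) * Real.exp (-μ * η ^ 2) := by positivity
  rw [profileIntegrand, norm_mul, norm_mul, norm_pow, norm_mul, Complex.norm_I, one_mul,
    Complex.norm_real, Complex.norm_real, Real.norm_eq_abs, Real.norm_of_nonneg h,
    mul_comm Complex.I (Complex.ofReal _), Complex.norm_exp_ofReal_mul_I, mul_one]

theorem Real.measurable_sign : Measurable Real.sign :=
  Measurable.ite measurableSet_Iio measurable_const
    (Measurable.ite measurableSet_Ioi measurable_const measurable_const)

theorem measurable_profileIntegrand (μ : ℝ) (l : ℕ) (a x : ℝ) :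
    Measurable (profileIntegrand μ l a x) := by
  have := Real.measurable_sign
  unfold profileIntegrand
  fun_prop

theorem continuous_profileIntegrand (μ : ℝ) (l : ℕ) (η : ℝ) :
    Continuous fun p : ℝ × ℝ => profileIntegrand μ l p.1 p.2 η := by
  unfold profileIntegrand
  fun_prop

theorem pow_mul_rpow_neg_half {η : ℝ} (hη : 0 < η) (l : ℕ) :
    η ^ l * η ^ (-(1:ℝ)/2) = η ^ ((l : ℝ) - 1 / 2) := by
  rw [← Real.rpow_natCast η l, ← Real.rpow_add hη]
  ring_nf

theorem integrable_norm_profileIntegrand {μ : ℝ} (hμ : 0 < μ) (l : ℕ) :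
    Integrable fun η : ℝ => |η| ^ l * (|η| ^ (-(1:ℝ)/2) * Real.exp (-μ * η ^ 2)) := by
  set f : ℝ → ℝ := fun η => |η| ^ l * (|η| ^ (-(1:ℝ)/2) * Real.exp (-μ * η ^ 2)) with hf
  have hs : (-1 : ℝ) < (l : ℝ) - 1 / 2 := by
    have : (0 : ℝ) ≤ l := Nat.cast_nonneg l
    linarith
  have hpos : IntegrableOn f (Set.Ioi 0) := by
    refine (integrableOn_rpow_mul_exp_neg_mul_sq hμ hs).congr_fun (fun η hη => ?_)
      measurableSet_Ioi
    have hη : 0 < η := hη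
    simp only [hf, abs_of_pos hη, ← mul_assoc, pow_mul_rpow_neg_half hη]
  have hneg : IntegrableOn f (Set.Iio 0) := by
    have h := hpos.integrable_indicator measurableSet_Ioi |>.comp_neg
    rw [← integrable_indicator_iff measurableSet_Iio]
    refine h.congr (Eventually.of_forall fun η => ?_)
    simp [Set.indicator, hf]
  rw [← integrableOn_univ, ← Set.Iio_union_Ici (a := (0 : ℝ)), integrableOn_union,
    integrableOn_Ici_iff_integrableOn_Ioi]
  exact ⟨hneg, hpos⟩

theorem integrable_profileIntegrand {μ : ℝ} (hμ : 0 < μ) (l : ℕ) (a x : ℝ) :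
    Integrable (profileIntegrand μ l a x) :=
  (integrable_norm_profileIntegrand hμ l).mono'
    (measurable_profileIntegrand μ l a x).aestronglyMeasurable
    (Eventually.of_forall fun η => (norm_profileIntegrand μ l a x η).le)

/-- The self-similar profile of `kernelV`, up to a constant factor. -/
noncomputable def profileV (μ : ℝ) (l : ℕ) (a x : ℝ) : ℂ :=
  ∫ η : ℝ, profileIntegrand μ l a x η

theorem continuous_profileV {μ : ℝ} (hμ : 0 < μ) (l : ℕ) :
    Continuous fun p : ℝ × ℝ => profileV μ l p.1 p.2 :=
  continuous_of_dominated
    (fun p => (measurable_profileIntegrand μ l p.1 p.2).aestronglyMeasurable)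
    (fun p => Eventually.of_forall fun η => (norm_profileIntegrand μ l p.1 p.2 η).le)
    (integrable_norm_profileIntegrand hμ l)
    (Eventually.of_forall fun η => continuous_profileIntegrand μ l η)

theorem exists_norm_profileV_le (μ : ℝ) (l : ℕ) :
    ∃ C, ∀ a x, ‖profileV μ l a x‖ ≤ C :=
  ⟨∫ η : ℝ, |η| ^ l * (|η| ^ (-(1:ℝ)/2) * Real.exp (-μ * η ^ 2)), fun a x =>
    (norm_integral_le_integral_norm _).trans_eq (by simp_rw [norm_profileIntegrand])⟩

theorem I_pow_mul_exp_add_sq (l : ℕ) :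
    (I ^ l * exp (I * ((Real.pi / 4 : ℝ) : ℂ)) +
      (-I) ^ l * exp (-(I * ((Real.pi / 4 : ℝ) : ℂ)))) ^ 2 = 2 := by
  have h1 : exp (I * ((Real.pi / 4 : ℝ) : ℂ)) ^ 2 = I := by
    rw [← Complex.exp_nat_mul]
    refine Eq.trans (congrArg exp ?_) Complex.exp_pi_div_two_mul_I
    push_cast
    ring
  have h2 : exp (-(I * ((Real.pi / 4 : ℝ) : ℂ))) ^ 2 = -I := by
    rw [Complex.exp_neg, inv_pow, h1, Complex.inv_I]
  have h3 : exp (I * ((Real.pi / 4 : ℝ) : ℂ)) * exp (-(I * ((Real.pi / 4 : ℝ) : ℂ))) = 1 := by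
    rw [← Complex.exp_add, add_neg_cancel, Complex.exp_zero]
  have h4 : (I ^ l) ^ 2 = (-1) ^ l := by rw [← pow_mul, mul_comm, pow_mul, I_sq]
  have h5 : ((-I) ^ l) ^ 2 = (-1) ^ l := by rw [← pow_mul, mul_comm, pow_mul, neg_sq, I_sq]
  have h6 : I ^ l * (-I) ^ l = 1 := by rw [← mul_pow]; simp
  linear_combination (I ^ l) ^ 2 * h1 + ((-I) ^ l) ^ 2 * h2 + I * h4 - I * h5 +
    2 * (I ^ l * (-I) ^ l) * h3 + 2 * h6

theorem norm_profileV_zero {μ : ℝ} (hμ : 0 < μ) (l : ℕ) :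
    ‖profileV μ l 0 0‖ = √2 / 2 *
      (Real.Gamma ((1 + 2 * (l : ℝ)) / 4) / μ ^ ((1 + 2 * (l : ℝ)) / 4)) := by
  set J : ℝ := ∫ η in Set.Ioi (0 : ℝ), η ^ ((l : ℝ) - 1 / 2) * Real.exp (-μ * η ^ (2 : ℝ)) with hJ
  have hl : (0 : ℝ) ≤ l := Nat.cast_nonneg l
  have hJ' : J = 1 / 2 *
      (Real.Gamma ((1 + 2 * (l : ℝ)) / 4) / μ ^ ((1 + 2 * (l : ℝ)) / 4)) := by
    rw [hJ, _root_.integral_rpow_mul_exp_neg_mul_rpow two_pos (by linarith) hμ,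
      show ((l : ℝ) - 1 / 2 + 1) / 2 = (1 + 2 * (l : ℝ)) / 4 by ring,
      show -((l : ℝ) - 1 / 2 + 1) / 2 = -((1 + 2 * (l : ℝ)) / 4) by ring, Real.rpow_neg hμ.le]
    ring
  have hpos : ∫ η in Set.Ioi (0 : ℝ), profileIntegrand μ l 0 0 η =
      I ^ l * exp (I * ((Real.pi / 4 : ℝ) : ℂ)) * (J : ℂ) := by
    rw [hJ, ← integral_complex_ofReal, ← integral_const_mul]
    refine setIntegral_congr_fun measurableSet_Ioi fun η hη => ?_
    have hη : 0 < η := hη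
    simp only [profileIntegrand, abs_of_pos hη, Real.sign_of_pos hη, Real.rpow_two,
      ← pow_mul_rpow_neg_half hη, neg_zero, zero_div, zero_mul, zero_add, add_zero, mul_one,
      mul_pow]
    push_cast
    ring
  have hneg : ∫ η in Set.Iic (0 : ℝ), profileIntegrand μ l 0 0 η =
      (-I) ^ l * exp (-(I * ((Real.pi / 4 : ℝ) : ℂ))) * (J : ℂ) := by
    have h := integral_comp_neg_Ioi (0 : ℝ) (profileIntegrand μ l 0 0)
    rw [neg_zero] at h
    rw [← h, hJ, ← integral_complex_ofReal, ← integral_const_mul]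
    refine setIntegral_congr_fun measurableSet_Ioi fun η hη => ?_
    have hη : 0 < η := hη
    simp only [profileIntegrand, abs_neg, abs_of_pos hη, Real.sign_neg, Real.sign_of_pos hη,
      Real.rpow_two, ← pow_mul_rpow_neg_half hη, neg_zero, zero_div, zero_mul, zero_add, add_zero,
      mul_neg, mul_one, neg_sq, ofReal_neg, ← neg_mul, mul_pow]
    push_cast
    ring
  have hint := integrable_profileIntegrand hμ l 0 0
  rw [profileV, ← intervalIntegral.integral_Iic_add_Ioi hint.integrableOn hint.integrableOn,
    hpos, hneg, ← add_mul, add_comm, norm_mul, hJ', Complex.norm_real, Real.norm_of_nonneg]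
  · have h := congrArg norm (I_pow_mul_exp_add_sq l)
    rw [norm_pow, Complex.norm_ofNat] at h
    rw [← h, Real.sqrt_sq (norm_nonneg _)]
    ring
  · have := Real.Gamma_pos_of_pos (show 0 < (1 + 2 * (l : ℝ)) / 4 by positivity)
    positivity

theorem kernelV_eq_profileV (μ : ℝ) (l : ℕ) (x y : ℝ) {t : ℝ} (ht : 0 < t) :
    kernelV μ l x y t =
      ((t ^ (-((3 : ℝ)/4 + (l : ℝ)/2)) / (4 * Real.pi ^ ((3:ℝ)/2)) : ℝ) : ℂ) *
        profileV μ l (y ^ 2 / √t) (x / √t) := by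
  set c : ℝ := √t with hc
  have hc0 : 0 < c := Real.sqrt_pos.2 ht
  have hct : t = c ^ 2 := (Real.sq_sqrt ht.le).symm
  have hpt : ∀ ξ : ℝ, (Complex.I * (ξ : ℂ)) ^ l *
      ((|ξ| ^ (-(1:ℝ)/2) * Real.exp (-(μ * t) * ξ ^ 2) : ℝ) : ℂ) *
      Complex.exp (Complex.I *
        ((- y ^ 2 / (4 * t * ξ) + (Real.pi / 4) * Real.sign ξ + x * ξ : ℝ) : ℂ)) =
      ((c ^ ((1 : ℝ) / 2 - l) : ℝ) : ℂ) * profileIntegrand μ l (y ^ 2 / c) (x / c) (c * ξ) := by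
    intro ξ
    have hsign : Real.sign (c * ξ) = Real.sign ξ := by
      rcases lt_trichotomy ξ 0 with h | rfl | h
      · rw [Real.sign_of_neg h, Real.sign_of_neg (mul_neg_of_pos_of_neg hc0 h)]
      · rw [mul_zero]
      · rw [Real.sign_of_pos h, Real.sign_of_pos (mul_pos hc0 h)]
    have hphase : -(y ^ 2 / c) / (4 * (c * ξ)) + Real.pi / 4 * Real.sign (c * ξ) +
        x / c * (c * ξ) = - y ^ 2 / (4 * t * ξ) + (Real.pi / 4) * Real.sign ξ + x * ξ := by
      rw [hsign, hct]
      congr 1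
      · congr 1
        rw [← neg_div, div_div]
        ring_nf
      · field_simp
    have hexp : -μ * (c * ξ) ^ 2 = -(μ * t) * ξ ^ 2 := by rw [hct]; ring
    have hpow : c ^ ((1 : ℝ) / 2 - l) * c ^ l * c ^ (-(1:ℝ)/2) = 1 := by
      rw [← Real.rpow_natCast c l, ← Real.rpow_add hc0, ← Real.rpow_add hc0]
      ring_nf
      exact Real.rpow_zero c
    have hpow' : ((c ^ ((1 : ℝ) / 2 - l) : ℝ) : ℂ) * (c : ℂ) ^ l * ((c ^ (-(1:ℝ)/2) : ℝ) : ℂ) =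
        1 := by exact_mod_cast hpow
    rw [profileIntegrand, hphase, hexp, abs_mul, abs_of_pos hc0,
      Real.mul_rpow hc0.le (abs_nonneg ξ)]
    simp only [ofReal_mul, mul_pow]
    linear_combination (-(I ^ l * (ξ : ℂ) ^ l * ((|ξ| ^ (-(1:ℝ)/2) : ℝ) : ℂ) *
      ((Real.exp (-(μ * t) * ξ ^ 2) : ℝ) : ℂ) * Complex.exp (Complex.I *
        ((- y ^ 2 / (4 * t * ξ) + (Real.pi / 4) * Real.sign ξ + x * ξ : ℝ) : ℂ)))) * hpow'
  have hscale : t ^ (-((3 : ℝ)/4 + (l : ℝ)/2)) =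
      t ^ (-(1:ℝ)/2) * (c ^ ((1 : ℝ) / 2 - l) * c⁻¹) := by
    rw [hct, ← Real.rpow_neg_one c, ← Real.rpow_two, ← Real.rpow_mul hc0.le,
      ← Real.rpow_mul hc0.le, ← Real.rpow_add hc0, ← Real.rpow_add hc0]
    ring_nf
  rw [kernelV]
  simp_rw [hpt]
  rw [integral_const_mul, Measure.integral_comp_mul_left, abs_of_pos (inv_pos.2 hc0), hscale,
    profileV, Complex.real_smul]
  push_cast
  ring

theorem enorm_le_eLpNorm_top_of_continuous {X E : Type*} [TopologicalSpace X] [MeasurableSpace X]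
    {ν : Measure X} [ν.IsOpenPosMeasure] [NormedAddCommGroup E] {f : X → E} (hf : Continuous f)
    (x : X) : ‖f x‖ₑ ≤ eLpNorm f ⊤ ν := by
  rw [eLpNorm_exponent_top]
  have hclosed : IsClosed {x | ‖f x‖ₑ ≤ eLpNormEssSup f ν} :=
    isClosed_le hf.enorm continuous_const
  have hdense : Dense {x | ‖f x‖ₑ ≤ eLpNormEssSup f ν} :=
    Measure.dense_of_ae ae_le_eLpNormEssSup
  have h := hdense.closure_eq
  rw [hclosed.closure_eq] at h
  exact Set.eq_univ_iff_forall.1 h x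

theorem continuous_integral_kernelV_mul {μ : ℝ} (hμ : 0 < μ) (l : ℕ) {t : ℝ} (ht : 0 < t)
    {m : ℝ → ℂ} (hm : Integrable m) :
    Continuous fun q : ℝ × ℝ => ∫ w : ℝ, kernelV μ l q.1 (q.2 - w) t * m w := by
  obtain ⟨C, hC⟩ := exists_norm_profileV_le μ l
  have hcont := continuous_profileV hμ l
  simp_rw [kernelV_eq_profileV μ l _ _ ht, mul_assoc, integral_const_mul]
  refine continuous_const.mul (continuous_of_dominated (bound := fun w => C * ‖m w‖) (fun q => ?_)
    (fun q => Eventually.of_forall fun w => ?_) (hm.norm.const_mul C)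
    (Eventually.of_forall fun w => ?_))
  · refine AEStronglyMeasurable.mul (Continuous.aestronglyMeasurable ?_) hm.aestronglyMeasurable
    exact hcont.comp (f := fun w : ℝ => ((q.2 - w) ^ 2 / √t, q.1 / √t)) (by fun_prop)
  · rw [norm_mul]
    exact mul_le_mul_of_nonneg_right (hC _ _) (norm_nonneg _)
  · refine Continuous.mul ?_ continuous_const
    exact hcont.comp (f := fun q : ℝ × ℝ => ((q.2 - w) ^ 2 / √t, q.1 / √t)) (by fun_prop)

theorem tendsto_integral_kernelV_mul {μ : ℝ} (hμ : 0 < μ) (l : ℕ) {m : ℝ → ℂ}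
    (hm : Integrable m) :
    Tendsto (fun t : ℝ => ((t ^ ((3 : ℝ)/4 + (l : ℝ)/2) : ℝ) : ℂ) *
        ∫ w : ℝ, kernelV μ l 0 (0 - w) t * m w) atTop
      (nhds (((1 / (4 * Real.pi ^ ((3:ℝ)/2)) : ℝ) : ℂ) * (profileV μ l 0 0 * ∫ w, m w))) := by
  obtain ⟨C, hC⟩ := exists_norm_profileV_le μ l
  have hcont := continuous_profileV hμ l
  have hlim : Tendsto (fun t : ℝ => ∫ w : ℝ, profileV μ l ((0 - w) ^ 2 / √t) (0 / √t) * m w) atTop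
      (nhds (∫ w, profileV μ l 0 0 * m w)) := by
    refine tendsto_integral_filter_of_dominated_convergence (fun w => C * ‖m w‖)
      (Eventually.of_forall fun t => ?_)
      (Eventually.of_forall fun t => Eventually.of_forall fun w => ?_) (hm.norm.const_mul C)
      (Eventually.of_forall fun w => ?_)
    · refine AEStronglyMeasurable.mul (Continuous.aestronglyMeasurable ?_) hm.aestronglyMeasurable
      exact hcont.comp (f := fun w : ℝ => ((0 - w) ^ 2 / √t, 0 / √t)) (by fun_prop)
    · rw [norm_mul]
      exact mul_le_mul_of_nonneg_right (hC _ _) (norm_nonneg _)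
    · have hdiv (b : ℝ) : Tendsto (fun t : ℝ => b / √t) atTop (nhds 0) :=
        tendsto_const_nhds.div_atTop Real.tendsto_sqrt_atTop
      have hpair : Tendsto (fun t : ℝ => ((0 - w) ^ 2 / √t, 0 / √t)) atTop
          (nhds ((0 : ℝ), (0 : ℝ))) :=
        (hdiv ((0 - w) ^ 2)).prodMk_nhds (hdiv 0)
      have hzero : Tendsto (fun p : ℝ × ℝ => profileV μ l p.1 p.2) (nhds (0, 0))
          (nhds (profileV μ l 0 0)) := hcont.tendsto (0, 0)
      have hprofile : Tendsto (fun t : ℝ => profileV μ l ((0 - w) ^ 2 / √t) (0 / √t)) atTop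
          (nhds (profileV μ l 0 0)) := by
        have hcomp := Tendsto.comp hzero hpair
        rw [Function.comp_def] at hcomp
        exact hcomp
      exact hprofile.mul_const (m w)
  rw [integral_const_mul] at hlim
  refine (hlim.const_mul _).congr' ?_
  filter_upwards [eventually_gt_atTop 0] with t ht
  simp_rw [kernelV_eq_profileV μ l _ _ ht, mul_assoc, integral_const_mul]
  rw [← mul_assoc, ← ofReal_mul, Real.rpow_neg ht.le, ← mul_div_assoc,
    mul_inv_cancel₀ (Real.rpow_pos_of_pos ht _).ne']

/-- lower bound for the `L^∞` norm of the profile `𝒱_{j,l}`.  Since only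
`g = ∂_y^j u₀ ∈ L¹(ℝ²)` enters, the statement is quantified over `g`;
`M_j(w) = ∫ g(x,w) dx`. -/
theorem kernelV_profile_lower_bound (μ : ℝ) (hμ : 0 < μ) (j l : ℕ) :
    ∀ g : ℝ × ℝ → ℝ, Integrable g (volume : Measure (ℝ × ℝ)) →
      ENNReal.ofReal
          (Real.Gamma ((1 + 2 * (l : ℝ)) / 4) /
              (2 ^ ((5 : ℝ)/2) * Real.pi ^ ((3 : ℝ)/2) * μ ^ ((1 + 2 * (l : ℝ)) / 4)) *
            |∫ y : ℝ, ∫ x : ℝ, g (x, y)|)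
        ≤ Filter.liminf
            (fun t : ℝ => ENNReal.ofReal (t ^ ((3 : ℝ)/4 + (l : ℝ)/2)) *
              eLpNorm (fun q : ℝ × ℝ =>
                  ∫ w : ℝ, kernelV μ l q.1 (q.2 - w) t * ((∫ x : ℝ, g (x, w) : ℝ) : ℂ)) ⊤
                (volume : Measure (ℝ × ℝ)))
            Filter.atTop := by
  intro g hg
  have hm : Integrable fun w : ℝ => ((∫ x : ℝ, g (x, w) : ℝ) : ℂ) := hg.integral_prod_right.ofReal
  have hlim := (tendsto_integral_kernelV_mul hμ l hm).enorm
  have hconst : ENNReal.ofReal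
      (Real.Gamma ((1 + 2 * (l : ℝ)) / 4) /
          (2 ^ ((5 : ℝ)/2) * Real.pi ^ ((3 : ℝ)/2) * μ ^ ((1 + 2 * (l : ℝ)) / 4)) *
        |∫ y : ℝ, ∫ x : ℝ, g (x, y)|) =
      ‖((1 / (4 * Real.pi ^ ((3:ℝ)/2)) : ℝ) : ℂ) *
        (profileV μ l 0 0 * ∫ w : ℝ, ((∫ x : ℝ, g (x, w) : ℝ) : ℂ))‖ₑ := by
    have hsqrt : (2 : ℝ) ^ ((5 : ℝ)/2) = 4 * √2 := by
      rw [show (5 : ℝ) / 2 = (2 : ℕ) + 1 / 2 by norm_num, Real.rpow_add two_pos,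
        Real.rpow_natCast, Real.sqrt_eq_rpow]
      norm_num
    rw [← ofReal_norm, norm_mul, norm_mul, integral_complex_ofReal, Complex.norm_real,
      Complex.norm_real, norm_profileV_zero hμ, Real.norm_of_nonneg (by positivity),
      Real.norm_eq_abs, hsqrt]
    congr 1
    rw [← mul_assoc]
    congr 1
    have h2 : √2 * √2 = 2 := Real.mul_self_sqrt zero_le_two
    have h2' : √2 ^ 2 = 2 := Real.sq_sqrt zero_le_two
    field_simp
    linear_combination -h2'
  rw [hconst, ← hlim.liminf_eq]
  refine liminf_le_liminf ?_
  filter_upwards [eventually_gt_atTop 0] with t ht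
  rw [enorm_mul, ← ofReal_norm, Complex.norm_real,
    Real.norm_of_nonneg (Real.rpow_nonneg ht.le _)]
  gcongr
  exact enorm_le_eLpNorm_top_of_continuous (continuous_integral_kernelV_mul hμ l ht hm) (0, 0)
end
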